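/- Fix reals t, v*, p̃ with t > 0 and p̃ ≥ 5t/4. Then the pair (q_N, q_NN) with q_NN = v* − t/2 and q_N = q_NN − (p̃ − 3t/2) is feasible and maximizes π_G over the feasible set; in particular the optimal subscription-fee difference is Δq = p̃ − 3t/2. -/

import Mathlib

/-- Content provider's stage-2 payoff. -/
noncomputable def piG (t ptil qN qNN : ℝ) : ℝ :=
  (qNN - ptil) * (1 / 2 - (qNN - qN - ptil) / (6 * t)) +
    qN * (1 / 2 + (qNN - qN - ptil) / (6 * t))

/-- Full-coverage feasibility constraints for the content provider. -/
def Feasible (t vstar ptil qN qNN : ℝ) : Prop :=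
  (qNN - qN ≥ ptil →
    qN ≤ vstar - t / 2 ∧ qNN ≤ vstar - t / 2 + (qNN - qN - ptil) / 6) ∧
  (qNN - qN ≤ ptil →
    qNN ≤ vstar - t / 2 ∧ qN ≤ vstar - t / 2 - (qNN - qN - ptil) / 6)

/-- The payoff in terms of `qNN` and the net fee difference `d = qNN - qN - ptil`. -/
lemma piG_eq {t : ℝ} (ht : t ≠ 0) (ptil qN qNN : ℝ) :
    piG t ptil qN qNN =
      qNN - ptil - (qNN - qN - ptil) / 2 - (qNN - qN - ptil) ^ 2 / (6 * t) := by
  unfold piG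
  field_simp
  ring

/-- Completing the square in the net fee difference. -/
lemma piG_eq_sub_sq {t : ℝ} (ht : t ≠ 0) (ptil qN qNN : ℝ) :
    piG t ptil qN qNN =
      qNN - ptil + 3 * t / 8 - (qNN - qN - ptil + 3 * t / 2) ^ 2 / (6 * t) := by
  rw [piG_eq ht]
  field_simp
  ring

/-- For p̃ ≥ 5t/4 the CP's optimum is q_NN = v* − t/2, q_N = q_NN − (p̃ − 3t/2). -/
theorem cp_optimum_high (t vstar ptil : ℝ) (ht : 0 < t) (hp : 5 * t / 4 ≤ ptil) :
    let qNN := vstar - t / 2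
    let qN := qNN - (ptil - 3 * t / 2)
    Feasible t vstar ptil qN qNN ∧
    (∀ qN' qNN' : ℝ, Feasible t vstar ptil qN' qNN' →
      piG t ptil qN' qNN' ≤ piG t ptil qN qNN) ∧
    qNN - qN = ptil - 3 * t / 2 := by
  intro qNN qN
  have hdiff : qNN - qN = ptil - 3 * t / 2 := sub_sub_cancel _ _
  have hopt : piG t ptil qN qNN = vstar - t / 2 - ptil + 3 * t / 8 := by
    rw [piG_eq_sub_sq ht.ne', hdiff]
    ring
  refine ⟨⟨fun h => ?_, fun _ => ⟨le_rfl, ?_⟩⟩, fun qN' qNN' ⟨hge, hle⟩ => ?_, hdiff⟩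
  · linarith
  · rw [hdiff]
    simp only [qN, qNN]
    linarith
  · rw [hopt]
    rcases le_total (qNN' - qN') ptil with h | h
    · rw [piG_eq_sub_sq ht.ne']
      have hsq : 0 ≤ (qNN' - qN' - ptil + 3 * t / 2) ^ 2 / (6 * t) := by positivity
      linarith [(hle h).1]
    · rw [piG_eq ht.ne']
      have hsq : 0 ≤ (qNN' - qN' - ptil) ^ 2 / (6 * t) := by positivity
      linarith [(hge h).2]
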